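/- arXiv:1805.06859 — 4 statements merged into one kernel-verified Lean document; each statement's English description precedes it below -/
import Mathlib

section
/- For every a > 0, lim_{ε→0⁺} ∫_{−a}^{a} y · (y − εi)^{−2} dy = πi. (This computation from Lemma 5.1 establishes that the variant volume μ′_h of a half circle in DH¹ also equals πi.) -/
open MeasureTheory Filter

/-- A primitive in `y` of `y / (y - εi)²`, for `ε > 0`. The logarithm of `y - εi` is rotated by `i`
so that its argument stays in the right half-plane. -/
theorem hasDerivAt_log_sub_div {ε : ℝ} (hε : 0 < ε) (y : ℝ) :
    HasDerivAt
      (fun y : ℝ => Complex.log ((ε : ℂ) + y * Complex.I) - ε * Complex.I / (y - ε * Complex.I))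
      ((y : ℂ) * (((y : ℂ) - (ε : ℂ) * Complex.I) ^ 2)⁻¹) y := by
  have hy : HasDerivAt (fun y : ℝ => (y : ℂ)) 1 y := Complex.ofRealCLM.hasDerivAt
  have hd : (y : ℂ) - ε * Complex.I ≠ 0 := fun h => hε.ne' (by simpa using congrArg Complex.im h)
  have hr : (ε : ℂ) + y * Complex.I = Complex.I * (y - ε * Complex.I) := by
    linear_combination (ε : ℂ) * Complex.I_sq
  have hlog := ((hy.mul_const Complex.I).const_add (ε : ℂ)).clog_real (Or.inl (by simpa using hε))
  have hdiv := (hasDerivAt_const y ((ε : ℂ) * Complex.I)).div (hy.sub_const (ε * Complex.I)) hd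
  refine (hlog.sub hdiv).congr_deriv ?_
  rw [hr]
  field_simp [Complex.I_ne_zero]
  ring

theorem tendsto_log_sub_div {y : ℝ} (hy : y ≠ 0) :
    Tendsto
      (fun ε : ℝ => Complex.log ((ε : ℂ) + y * Complex.I) - ε * Complex.I / (y - ε * Complex.I))
      (nhds 0) (nhds (Complex.log (y * Complex.I))) := by
  have h : ContinuousAt
      (fun ε : ℝ => Complex.log ((ε : ℂ) + y * Complex.I) - ε * Complex.I / (y - ε * Complex.I))
      0 := by
    refine (ContinuousAt.clog (by fun_prop) (Or.inr (by simpa using hy))).sub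
      (ContinuousAt.div (by fun_prop) (by fun_prop) (by simpa using hy))
  simpa [ContinuousAt] using h

/-- **Lemma 5.1 computation**: `∫_{-a}^{a} y (y - εi)^{-2} dy → πi` as `ε → 0⁺`
(the variant volume `μ'_h` of a half circle in `DH¹` also equals `πi`). -/
theorem dh1_half_circle_variant (a : ℝ) (ha : 0 < a) :
    Tendsto
      (fun ε : ℝ => ∫ y in (-a)..a, (y : ℂ) * (((y : ℂ) - (ε : ℂ) * Complex.I) ^ 2)⁻¹)
      (nhdsWithin 0 (Set.Ioi 0)) (nhds (Real.pi * Complex.I)) := by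
  have hval : Complex.log (a * Complex.I) - Complex.log ((-a : ℝ) * Complex.I)
      = Real.pi * Complex.I := by
    have hneg : ((-a : ℝ) : ℂ) * Complex.I = a * -Complex.I := by push_cast; ring
    rw [hneg, Complex.log_ofReal_mul ha Complex.I_ne_zero,
      Complex.log_ofReal_mul ha (neg_ne_zero.2 Complex.I_ne_zero), Complex.log_I,
      Complex.log_neg_I]
    ring
  rw [← hval]
  refine (((tendsto_log_sub_div ha.ne').sub
    (tendsto_log_sub_div (neg_ne_zero.2 ha.ne'))).mono_left nhdsWithin_le_nhds).congr' ?_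
  filter_upwards [self_mem_nhdsWithin] with ε hε
  refine (intervalIntegral.integral_eq_sub_of_hasDerivAt
    (fun y _ => hasDerivAt_log_sub_div hε y) (Continuous.intervalIntegrable ?_ _ _)).symm
  refine Continuous.mul (by fun_prop) (Continuous.inv₀ (by fun_prop) fun y => pow_ne_zero 2 ?_)
  exact fun h => (ne_of_gt hε) (by simpa using congrArg Complex.im h)
end

section
/- Let a > 0, c₀ ≥ 1, and let c : [0, a] → ℝ be a measurable function with 1 ≤ c(y) ≤ c₀ for all y ∈ [0, a]. Then for every ε > 0, ∫_0^a 2 c(y) ε / (y² + c(y)² ε²) dy ≤ 2π + 2(c₀ − 1). (The key uniform boundedness estimate in the proof of Lemma 5.1, obtained by splitting the integral at y = ε and y = c₀ε and using the monotonicity of t ↦ 2t/(y² + t²).) -/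
open MeasureTheory Filter

theorem hasDerivAt_two_mul_arctan_div {k : ℝ} (hk : 0 < k) (y : ℝ) :
    HasDerivAt (fun x => 2 * Real.arctan (x / k)) (2 * k / (y ^ 2 + k ^ 2)) y := by
  have h := (((hasDerivAt_id y).div_const k).arctan).const_mul 2
  refine h.congr_deriv ?_
  have h1 : y ^ 2 + k ^ 2 ≠ 0 := by positivity
  have h2 : 1 + (y / k) ^ 2 ≠ 0 := by positivity
  simp only [id]
  field_simp
  ring

theorem continuous_poisson_kernel {k : ℝ} (hk : 0 < k) :
    Continuous fun y : ℝ => 2 * k / (y ^ 2 + k ^ 2) :=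
  continuous_const.div (by fun_prop) fun y => by positivity

theorem integral_poisson_kernel_le {k : ℝ} (hk : 0 < k) (a : ℝ) :
    ∫ y in (0 : ℝ)..a, 2 * k / (y ^ 2 + k ^ 2) ≤ Real.pi := by
  rw [intervalIntegral.integral_eq_sub_of_hasDerivAt
    (fun y _ => hasDerivAt_two_mul_arctan_div hk y)
    ((continuous_poisson_kernel hk).intervalIntegrable 0 a)]
  have := Real.arctan_lt_pi_div_two (a / k)
  simp only [zero_div, Real.arctan_zero]
  linarith

theorem poisson_kernel_le_of_le {s t y : ℝ} (hs : 0 < s) (hst : s ≤ t) (hy : y ^ 2 ≤ s * t) :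
    2 * t / (y ^ 2 + t ^ 2) ≤ 2 * s / (y ^ 2 + s ^ 2) := by
  have ht : 0 < t := hs.trans_le hst
  rw [div_le_div_iff₀ (by positivity) (by positivity)]
  nlinarith [mul_nonneg (sub_nonneg.2 hst) (sub_nonneg.2 hy)]

theorem poisson_kernel_le_of_ge {s t y : ℝ} (ht : 0 < t) (hts : t ≤ s) (hy : s * t ≤ y ^ 2) :
    2 * t / (y ^ 2 + t ^ 2) ≤ 2 * s / (y ^ 2 + s ^ 2) := by
  have hs : 0 < s := ht.trans_le hts
  rw [div_le_div_iff₀ (by positivity) (by positivity)]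
  nlinarith [mul_nonneg (sub_nonneg.2 hts) (sub_nonneg.2 hy)]

theorem poisson_kernel_le_inv {t y : ℝ} (hy : 0 < y) :
    2 * t / (y ^ 2 + t ^ 2) ≤ 1 / y := by
  rw [div_le_div_iff₀ (by positivity) hy]
  nlinarith [sq_nonneg (y - t)]

theorem poisson_kernel_le_majorant {s t r y : ℝ} (hs : 0 < s) (hst : s ≤ t) (htr : t ≤ r)
    (hy : 0 < y) :
    2 * t / (y ^ 2 + t ^ 2) ≤ 2 * s / (y ^ 2 + s ^ 2) + 2 * r / (y ^ 2 + r ^ 2)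
      + (Set.Icc s r).indicator (fun _ => 1 / s) y := by
  have ht : 0 < t := hs.trans_le hst
  have hr : 0 < r := ht.trans_le htr
  have h1 : 0 ≤ 2 * s / (y ^ 2 + s ^ 2) := by positivity
  have h2 : 0 ≤ 2 * r / (y ^ 2 + r ^ 2) := by positivity
  have h3 : 0 ≤ (Set.Icc s r).indicator (fun _ => 1 / s) y :=
    Set.indicator_nonneg (fun _ _ => by positivity) y
  rcases lt_or_ge y s with hys | hys
  · linarith [poisson_kernel_le_of_le hs hst (y := y) (by nlinarith)]
  rcases lt_or_ge r y with hyr | hyr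
  · linarith [poisson_kernel_le_of_ge ht htr (y := y) (by nlinarith)]
  rw [Set.indicator_of_mem (Set.mem_Icc.2 ⟨hys, hyr⟩)]
  linarith [poisson_kernel_le_inv hy (t := t), one_div_le_one_div_of_le hs hys]

/-- **Key uniform estimate in the proof of Lemma 5.1**: if `c` is measurable with
`1 ≤ c(y) ≤ c₀` on `[0, a]`, then for every `ε > 0`,
`∫_0^a 2c(y)ε/(y² + c(y)²ε²) dy ≤ 2π + 2(c₀ - 1)`. -/
theorem dh1_uniform_bound (a c₀ : ℝ) (ha : 0 < a) (hc₀ : 1 ≤ c₀)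
    (c : ℝ → ℝ) (hc : Measurable c)
    (hc1 : ∀ y ∈ Set.Icc 0 a, 1 ≤ c y) (hc2 : ∀ y ∈ Set.Icc 0 a, c y ≤ c₀)
    (ε : ℝ) (hε : 0 < ε) :
    ∫ y in (0 : ℝ)..a, 2 * c y * ε / (y ^ 2 + c y ^ 2 * ε ^ 2)
      ≤ 2 * Real.pi + 2 * (c₀ - 1) := by
  have hr : 0 < c₀ * ε := by positivity
  have hεr : ε ≤ c₀ * ε := by nlinarith
  have hind : Integrable ((Set.Icc ε (c₀ * ε)).indicator fun _ : ℝ => 1 / ε) :=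
    (integrable_indicator_iff measurableSet_Icc).2 (integrableOn_const (by simp))
  have hint : ∫ y, (Set.Icc ε (c₀ * ε)).indicator (fun _ : ℝ => 1 / ε) y = c₀ - 1 := by
    rw [integral_indicator measurableSet_Icc, setIntegral_const, Real.volume_real_Icc_of_le hεr,
      smul_eq_mul]
    field_simp
  have hind_le : ∫ y in (0 : ℝ)..a, (Set.Icc ε (c₀ * ε)).indicator (fun _ : ℝ => 1 / ε) y
      ≤ c₀ - 1 := by
    rw [intervalIntegral.integral_of_le ha.le, ← hint]
    exact setIntegral_le_integral hind
      (Eventually.of_forall fun y => Set.indicator_nonneg (fun _ _ => by positivity) y)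
  have hi1 := (continuous_poisson_kernel hε).intervalIntegrable (μ := volume) 0 a
  have hi2 := (continuous_poisson_kernel hr).intervalIntegrable (μ := volume) 0 a
  have hi3 := hind.intervalIntegrable (a := 0) (b := a)
  have hmono : ∫ y in (0 : ℝ)..a, 2 * c y * ε / (y ^ 2 + c y ^ 2 * ε ^ 2)
      ≤ ∫ y in (0 : ℝ)..a, (2 * ε / (y ^ 2 + ε ^ 2) + 2 * (c₀ * ε) / (y ^ 2 + (c₀ * ε) ^ 2)
        + (Set.Icc ε (c₀ * ε)).indicator (fun _ => 1 / ε) y) := by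
    rw [intervalIntegral.integral_of_le ha.le, intervalIntegral.integral_of_le ha.le]
    refine integral_mono_of_nonneg ?_ ((hi1.add hi2).add hi3).1 ?_
    · filter_upwards [ae_restrict_mem measurableSet_Ioc] with y hy
      have : 0 < c y := one_pos.trans_le (hc1 y (Set.Ioc_subset_Icc_self hy))
      simp only [Pi.zero_apply]
      positivity
    · filter_upwards [ae_restrict_mem measurableSet_Ioc] with y hy
      have h1 := hc1 y (Set.Ioc_subset_Icc_self hy)
      have h2 := hc2 y (Set.Ioc_subset_Icc_self hy)
      rw [← mul_pow, mul_assoc]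
      exact poisson_kernel_le_majorant hε (by nlinarith) (by gcongr) hy.1
  rw [intervalIntegral.integral_add (hi1.add hi2) hi3, intervalIntegral.integral_add hi1 hi2]
    at hmono
  linarith [integral_poisson_kernel_le hε a, integral_poisson_kernel_le hr a]
end

section
/- Let a > 0, c₀ ≥ 1, and let c : [0, a] → ℝ be a measurable function with 1 ≤ c(y) ≤ c₀ for all y ∈ [0, a], and assume in addition that c is continuous at 0. Then lim_{ε→0⁺} ∫_0^a 2 c(y) ε / (y² + c(y)² ε²) dy = π. (This limit computation in the proof of Lemma 5.1 shows that the hemisphere-model volume μ_h of a half circle in DH¹ equals πi.) -/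
open MeasureTheory Filter

lemma integral_Ioi_two_mul_div_sq_add_sq {k : ℝ} (hk : 0 < k) :
    ∫ x in Set.Ioi (0 : ℝ), 2 * k / (x ^ 2 + k ^ 2) = Real.pi := by
  have h := integral_comp_mul_left_Ioi (fun x : ℝ => (1 + x ^ 2)⁻¹) 0 (inv_pos.mpr hk)
  have he : ∀ x : ℝ, 2 * k / (x ^ 2 + k ^ 2) = 2 * k⁻¹ * (1 + (k⁻¹ * x) ^ 2)⁻¹ := by
    intro x
    have h1 : x ^ 2 + k ^ 2 ≠ 0 := by positivity
    have h2 : 1 + (k⁻¹ * x) ^ 2 ≠ 0 := by positivity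
    field_simp
    ring
  simp_rw [he]
  rw [integral_const_mul, h, mul_zero, integral_Ioi_inv_one_add_sq, Real.arctan_zero]
  simp only [smul_eq_mul]
  field_simp
  ring

/-- Rescaling by `ε` turns the integral over `[0, a]` into one over the half-line. -/
lemma integral_two_mul_div_sq_add_sq_rescale {a ε : ℝ} (ha : 0 < a) (hε : 0 < ε) (c : ℝ → ℝ) :
    ∫ y in (0 : ℝ)..a, 2 * c y * ε / (y ^ 2 + c y ^ 2 * ε ^ 2) =
      ∫ x in Set.Ioi (0 : ℝ), (Set.Iic (a / ε)).indicator
        (fun x => 2 * c (ε * x) / (x ^ 2 + c (ε * x) ^ 2)) x := by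
  have h := intervalIntegral.smul_integral_comp_mul_left (a := 0) (b := a / ε)
    (fun y => 2 * c y * ε / (y ^ 2 + c y ^ 2 * ε ^ 2)) ε
  rw [mul_zero, mul_div_cancel₀ _ hε.ne'] at h
  rw [← h, setIntegral_indicator measurableSet_Iic, Set.Ioi_inter_Iic,
    intervalIntegral.integral_of_le (by positivity), smul_eq_mul, ← integral_const_mul]
  congr 1
  funext x
  rw [show (ε * x) ^ 2 + c (ε * x) ^ 2 * ε ^ 2 = ε ^ 2 * (x ^ 2 + c (ε * x) ^ 2) by ring,
    show ε * (2 * c (ε * x) * ε / (ε ^ 2 * (x ^ 2 + c (ε * x) ^ 2))) =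
      ε ^ 2 * (2 * c (ε * x)) / (ε ^ 2 * (x ^ 2 + c (ε * x) ^ 2)) by ring,
    mul_div_mul_left _ _ (by positivity)]

/-- **Limit computation in the proof of Lemma 5.1**: if `c` is measurable with
`1 ≤ c(y) ≤ c₀` on `[0, a]` and `c` is continuous at `0`, then
`∫_0^a 2c(y)ε/(y² + c(y)²ε²) dy → π` as `ε → 0⁺` (showing that the hemisphere-model
volume `μ_h` of a half circle in `DH¹` equals `πi`). -/
theorem dh1_limit_pi (a c₀ : ℝ) (ha : 0 < a) (hc₀ : 1 ≤ c₀)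
    (c : ℝ → ℝ) (hc : Measurable c)
    (hc1 : ∀ y ∈ Set.Icc 0 a, 1 ≤ c y) (hc2 : ∀ y ∈ Set.Icc 0 a, c y ≤ c₀)
    (hc0 : ContinuousWithinAt c (Set.Icc 0 a) 0) :
    Tendsto (fun ε : ℝ => ∫ y in (0 : ℝ)..a, 2 * c y * ε / (y ^ 2 + c y ^ 2 * ε ^ 2))
      (nhdsWithin 0 (Set.Ioi 0)) (nhds Real.pi) := by
  have hk : 0 < c 0 := zero_lt_one.trans_le (hc1 0 ⟨le_rfl, ha.le⟩)
  rw [← integral_Ioi_two_mul_div_sq_add_sq hk]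
  refine Tendsto.congr' (eventually_nhdsWithin_of_forall fun ε hε =>
    (integral_two_mul_div_sq_add_sq_rescale ha hε c).symm) ?_
  refine tendsto_integral_filter_of_dominated_convergence
    (fun x => 2 * c₀ * (1 + x ^ 2)⁻¹) ?_ ?_ ?_ ?_
  · refine Eventually.of_forall fun ε => Measurable.aestronglyMeasurable ?_
    exact Measurable.indicator (by fun_prop) measurableSet_Iic
  · refine eventually_nhdsWithin_of_forall fun ε (hε : 0 < ε) => ?_
    refine (ae_restrict_iff' measurableSet_Ioi).mpr (Eventually.of_forall fun x (hx : 0 < x) => ?_)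
    by_cases hxa : x ∈ Set.Iic (a / ε)
    · have hm : ε * x ∈ Set.Icc 0 a :=
        ⟨by positivity, by rw [mul_comm]; exact (le_div_iff₀ hε).mp hxa⟩
      have h1 := hc1 _ hm
      have h2 := hc2 _ hm
      rw [Set.indicator_of_mem hxa, Real.norm_of_nonneg (by positivity), ← div_eq_mul_inv]
      exact div_le_div₀ (by positivity) (by linarith) (by positivity) (by nlinarith)
    · rw [Set.indicator_of_notMem hxa, norm_zero]
      positivity
  · exact (integrable_inv_one_add_sq.const_mul _).integrableOn
  · refine (ae_restrict_iff' measurableSet_Ioi).mpr (Eventually.of_forall fun x (hx : 0 < x) => ?_)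
    have hmem : ∀ᶠ ε in nhdsWithin (0 : ℝ) (Set.Ioi 0), 0 < ε ∧ x ≤ a / ε := by
      filter_upwards [Ioo_mem_nhdsGT (div_pos ha hx)] with ε hε
      exact ⟨hε.1, (le_div_comm₀ hε.1 hx).mp hε.2.le⟩
    have hlim : Tendsto (fun ε => c (ε * x)) (nhdsWithin 0 (Set.Ioi 0)) (nhds (c 0)) := by
      refine hc0.tendsto.comp (tendsto_nhdsWithin_iff.mpr ⟨?_, ?_⟩)
      · have h : Tendsto (fun ε : ℝ => ε * x) (nhds 0) (nhds (0 * x)) :=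
          tendsto_id.mul_const x
        rw [zero_mul] at h
        exact h.mono_left nhdsWithin_le_nhds
      · filter_upwards [hmem] with ε hε
        exact ⟨(mul_pos hε.1 hx).le, by rw [mul_comm]; exact (le_div_iff₀ hε.1).mp hε.2⟩
    refine Tendsto.congr' (f₁ := fun ε => 2 * c (ε * x) / (x ^ 2 + c (ε * x) ^ 2)) ?_ ?_
    · filter_upwards [hmem] with ε hε
      exact (Set.indicator_of_mem (s := Set.Iic (a / ε)) hε.2
        (fun x => 2 * c (ε * x) / (x ^ 2 + c (ε * x) ^ 2))).symm
    · exact (hlim.const_mul 2).div ((hlim.pow 2).const_add _) (by positivity)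
end

section
/- Let p, q ≥ 1 be integers, n = p + q, and define f : {x ∈ ℝⁿ : x_n ≠ 0} → ℝ^{n+1} by f(x) = (y₀, y₁, …, y_n), where y₀ = (1 − Σ_{j=1}^p x_j² + Σ_{j=p+1}^{n} x_j²)/(2x_n), y_j = −x_j/x_n for 1 ≤ j ≤ n − 1, and y_n = (1 + Σ_{j=1}^p x_j² − Σ_{j=p+1}^{n} x_j²)/(2x_n). Then f is differentiable at every x with x_n ≠ 0, and for every tangent vector h ∈ ℝⁿ, writing k = Df(x)(h) ∈ ℝ^{n+1} (indexed 0, …, n), one has Σ_{j=0}^{p} k_j² − Σ_{j=p+1}^{n} k_j² = (Σ_{j=1}^p h_j² − Σ_{j=p+1}^{n} h_j²)/x_n². (The pullback-metric identity of Section 12.3: f is an isometric embedding of the half-space of ℝ^{p,q} with metric conformally rescaled by 1/x_n into the pseudosphere S^{p+q}_q with its induced pseudo-Riemannian metric.) -/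
open Finset

/-- The derivative of a diagonal quadratic form. -/
lemma hasFDerivAt_sum_mul_sq {ι : Type*} [Fintype ι] (ε : ι → ℝ) (x : EuclideanSpace ℝ ι) :
    HasFDerivAt (fun y : EuclideanSpace ℝ ι => ∑ i, ε i * y i ^ 2)
      (∑ i, (2 * (ε i * x i)) • (EuclideanSpace.proj i : EuclideanSpace ℝ ι →L[ℝ] ℝ)) x := by
  refine HasFDerivAt.fun_sum fun i _ => ?_
  have h := (EuclideanSpace.proj i : EuclideanSpace ℝ ι →L[ℝ] ℝ).hasFDerivAt (x := x)
  refine ((h.pow 2).const_mul (ε i)).congr_fderiv ?_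
  ext v
  simp
  ring

/-- The derivative of a quotient of real-valued functions, in divided form. -/
lemma HasFDerivAt.real_div {E : Type*} [NormedAddCommGroup E] [NormedSpace ℝ E]
    {u v : E → ℝ} {u' v' : E →L[ℝ] ℝ} {x : E} (hu : HasFDerivAt u u' x)
    (hv : HasFDerivAt v v' x) (hx : v x ≠ 0) :
    HasFDerivAt (fun y => u y / v y) ((v x)⁻¹ • u' - (u x / v x ^ 2) • v') x := by
  have hinv := (hasDerivAt_inv hx).comp_hasFDerivAt x hv
  have h := hu.mul hinv
  simp only [div_eq_mul_inv]
  refine h.congr_fderiv ?_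
  ext w
  simp
  ring

/-- A difference of complementary partial sums is a signed sum. -/
lemma sum_ite_sub_sum_ite {ι : Type*} [Fintype ι] (P R : ι → Prop) [DecidablePred P]
    [DecidablePred R] (hPR : ∀ i, R i ↔ ¬ P i) (a : ι → ℝ) :
    (∑ i, if P i then a i else 0) - (∑ i, if R i then a i else 0)
      = ∑ i, (if P i then 1 else -1) * a i := by
  rw [← Finset.sum_sub_distrib]
  refine Finset.sum_congr rfl fun i _ => ?_
  by_cases h : P i <;> simp [hPR, h]

/-- **Section 12.3, pullback-metric identity**: the generalized Nomizu map
`f : {x ∈ ℝⁿ : x_n ≠ 0} → ℝ^{n+1}` (with `n = p + q`) is differentiable, and its derivative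
pulls back the quadratic form of signature `(p+1, q)` defining the pseudosphere `S^{p+q}_q`
to the conformally rescaled `ℝ^{p,q}` metric `(Σ_{j≤p} h_j² − Σ_{j>p} h_j²)/x_n²`.
The domain coordinates are `x 0, …, x (n-1)`, representing `x₁, …, x_n` of the paper, and
the target coordinates are `y 0, …, y n`, representing `y₀, …, y_n`. -/
theorem nomizu_map_isometric_embedding (p q n : ℕ) (hp : 1 ≤ p) (hq : 1 ≤ q)
    (hn : n = p + q)
    (f : EuclideanSpace ℝ (Fin n) → EuclideanSpace ℝ (Fin (n + 1)))
    (hf0 : ∀ x : EuclideanSpace ℝ (Fin n), x ⟨n - 1, by omega⟩ ≠ 0 →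
      f x ⟨0, by omega⟩ =
        (1 - (∑ i : Fin n, if (i : ℕ) < p then x i ^ 2 else 0)
           + (∑ i : Fin n, if p ≤ (i : ℕ) then x i ^ 2 else 0)) / (2 * x ⟨n - 1, by omega⟩))
    (hfj : ∀ x : EuclideanSpace ℝ (Fin n), x ⟨n - 1, by omega⟩ ≠ 0 →
      ∀ j : Fin (n + 1), ∀ h1 : 1 ≤ (j : ℕ), ∀ h2 : (j : ℕ) ≤ n - 1,
        f x j = -x ⟨(j : ℕ) - 1, by omega⟩ / x ⟨n - 1, by omega⟩)
    (hfn : ∀ x : EuclideanSpace ℝ (Fin n), x ⟨n - 1, by omega⟩ ≠ 0 →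
      f x ⟨n, by omega⟩ =
        (1 + (∑ i : Fin n, if (i : ℕ) < p then x i ^ 2 else 0)
           - (∑ i : Fin n, if p ≤ (i : ℕ) then x i ^ 2 else 0)) / (2 * x ⟨n - 1, by omega⟩)) :
    ∀ x : EuclideanSpace ℝ (Fin n), x ⟨n - 1, by omega⟩ ≠ 0 →
      DifferentiableAt ℝ f x ∧
      ∀ h : EuclideanSpace ℝ (Fin n),
        (∑ j : Fin (n + 1), if (j : ℕ) ≤ p then fderiv ℝ f x h j ^ 2 else 0)
          - (∑ j : Fin (n + 1), if p < (j : ℕ) then fderiv ℝ f x h j ^ 2 else 0)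
        = ((∑ i : Fin n, if (i : ℕ) < p then h i ^ 2 else 0)
            - (∑ i : Fin n, if p ≤ (i : ℕ) then h i ^ 2 else 0)) / x ⟨n - 1, by omega⟩ ^ 2 := by
  obtain ⟨m, rfl⟩ : ∃ m, n = m + 1 := ⟨n - 1, by omega⟩
  intro x hx
  set ε : Fin (m + 1) → ℝ := fun i => if (i : ℕ) < p then 1 else -1 with hε
  have signed (y : EuclideanSpace ℝ (Fin (m + 1))) :
      (∑ i : Fin (m + 1), if (i : ℕ) < p then y i ^ 2 else 0)
        - (∑ i : Fin (m + 1), if p ≤ (i : ℕ) then y i ^ 2 else 0) = ∑ i, ε i * y i ^ 2 :=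
    sum_ite_sub_sum_ite _ _ (fun i => by omega) _
  have hlast : (⟨m + 1 - 1, by omega⟩ : Fin (m + 1)) = Fin.last m := rfl
  have hεlast : ε (Fin.last m) = -1 := by
    have : ¬ m < p := by omega
    simp [hε, this]
  simp only [hlast] at hf0 hfj hfn hx ⊢
  have hP (i : Fin (m + 1)) : HasFDerivAt (fun y : EuclideanSpace ℝ (Fin (m + 1)) => y i)
      (EuclideanSpace.proj i : EuclideanSpace ℝ (Fin (m + 1)) →L[ℝ] ℝ) x :=
    (EuclideanSpace.proj i : EuclideanSpace ℝ (Fin (m + 1)) →L[ℝ] ℝ).hasFDerivAt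
  have hQ := hasFDerivAt_sum_mul_sq ε x
  have hne : ∀ᶠ y in nhds x, y (Fin.last m) ≠ 0 :=
    (hP (Fin.last m)).continuousAt.eventually_ne hx
  have hx2 : 2 * x (Fin.last m) ≠ 0 := mul_ne_zero two_ne_zero hx
  have d0 := ((hQ.const_sub 1).real_div ((hP (Fin.last m)).const_mul 2) hx2).congr_of_eventuallyEq
    (f₁ := fun y => f y 0) (hne.mono fun y hy => by
      beta_reduce
      rw [← signed y]
      exact (hf0 y hy).trans (by ring))
  have dn := ((hQ.const_add 1).real_div ((hP (Fin.last m)).const_mul 2) hx2).congr_of_eventuallyEq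
    (f₁ := fun y => f y (Fin.last m).succ) (hne.mono fun y hy => by
      beta_reduce
      rw [← signed y]
      exact (hfn y hy).trans (by ring))
  have dj (i : Fin m) := ((hP i.castSucc).fun_neg.real_div (hP (Fin.last m)) hx).congr_of_eventuallyEq
    (f₁ := fun y => f y i.castSucc.succ) (hne.mono fun y hy =>
      hfj y hy i.castSucc.succ (by simp) (by simp))
  have hd : DifferentiableAt ℝ f x := by
    rw [differentiableAt_euclidean]
    intro j
    refine Fin.cases d0.differentiableAt (fun i => ?_) j
    exact Fin.lastCases dn.differentiableAt (fun i => (dj i).differentiableAt) i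
  refine ⟨hd, fun h => ?_⟩
  have comp {j : Fin (m + 2)} {L : EuclideanSpace ℝ (Fin (m + 1)) →L[ℝ] ℝ}
      (hL : HasFDerivAt (fun y => f y j) L x) : fderiv ℝ f x h j = L h :=
    congrArg (fun T : EuclideanSpace ℝ (Fin (m + 1)) →L[ℝ] ℝ => T h)
      (((EuclideanSpace.proj j : EuclideanSpace ℝ (Fin (m + 2)) →L[ℝ] ℝ).hasFDerivAt.comp x
        hd.hasFDerivAt).unique hL)
  have k0 := comp d0
  have kn := comp dn
  have kj (i : Fin m) := comp (dj i)
  rw [signed h, sum_ite_sub_sum_ite _ _ (fun i => by omega) _, Fin.sum_univ_succ,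
    Fin.sum_univ_castSucc]
  have hsign (i : Fin (m + 1)) :
      (if ((i.succ : Fin (m + 2)) : ℕ) ≤ p then (1 : ℝ) else -1) = ε i := by
    simp [hε]
  simp only [hsign, k0, kn, kj, hεlast]
  have hproj (i : Fin (m + 1)) :
      (EuclideanSpace.proj i : EuclideanSpace ℝ (Fin (m + 1)) →L[ℝ] ℝ) h = h i := rfl
  simp only [sub_apply, smul_apply, neg_apply, _root_.sum_apply, hproj, smul_eq_mul]
  simp only [Fin.sum_univ_castSucc, hεlast]
  set t := x (Fin.last m)
  set τ := h (Fin.last m)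
  have hmid : ∑ i : Fin m, ε i.castSucc * (t⁻¹ * -h i.castSucc - -x i.castSucc / t ^ 2 * τ) ^ 2
      = (∑ i : Fin m, ε i.castSucc * h i.castSucc ^ 2) / t ^ 2
        - (∑ i : Fin m, 2 * (ε i.castSucc * x i.castSucc) * h i.castSucc) * τ / t ^ 3
        + (∑ i : Fin m, ε i.castSucc * x i.castSucc ^ 2) * τ ^ 2 / t ^ 4 := by
    simp only [Finset.sum_mul, Finset.sum_div, ← Finset.sum_sub_distrib, ← Finset.sum_add_distrib]
    refine Finset.sum_congr rfl fun i _ => ?_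
    field_simp
    ring
  rw [hmid]
  simp
  field_simp
  ring
end
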